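/- There exists exactly one real number t₀ ∈ (0,1) with Y(t₀) = 1, and this t₀ satisfies 0.6263716633 − 10⁻¹⁰ < t₀ < 0.6263716633 + 10⁻¹⁰. -/

import Mathlib

noncomputable def h1 (t : ℝ) : ℝ := (2*t+1)/((3*t+1)*(1-t))

noncomputable def h2 (t : ℝ) : ℝ :=
  -(t^2*(1-t)*(5*t^2+36*t+18))/(2*(t+3)*(2*t+1)*(3*t+1)^2)

noncomputable def Y (t : ℝ) : ℝ := -1 + h1 t * Real.exp (h2 t)

lemma Y_hasDerivAt (t : ℝ) (h0 : 0 < t) (ht1 : t < 1) :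
    HasDerivAt Y (h1 t * Real.exp (h2 t) *
      (t^2*(864+4416*t+7536*t^2+4794*t^3+846*t^4+6*t^5-30*t^6) /
        (2*(t+3)^2*(2*t+1)^2*(3*t+1)^3*(1-t)))) t := by
  have e1 : t + 3 ≠ 0 := by positivity
  have e2 : 2*t+1 ≠ 0 := by positivity
  have e3 : 3*t+1 ≠ 0 := by positivity
  have e4 : 1 - t ≠ 0 := by linarith
  have hi := hasDerivAt_id' t
  have dA : HasDerivAt (fun x : ℝ => x + 3) 1 t := hi.add_const 3
  have dB : HasDerivAt (fun x : ℝ => 2*x+1) (2*1) t := (hi.const_mul 2).add_const 1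
  have dC : HasDerivAt (fun x : ℝ => 3*x+1) (3*1) t := (hi.const_mul 3).add_const 1
  have dU : HasDerivAt (fun x : ℝ => 1 - x) (-1) t := hi.const_sub 1
  have d1 : HasDerivAt h1 _ t := dB.fun_div (dC.fun_mul dU) (mul_ne_zero e3 e4)
  have dQ : HasDerivAt (fun x : ℝ => 5*x^2+36*x+18) _ t :=
    (((hi.fun_pow 2).const_mul 5).fun_add (hi.const_mul 36)).add_const 18
  have d2 : HasDerivAt h2 _ t :=
    (((hi.fun_pow 2).fun_mul dU).fun_mul dQ).fun_neg.fun_div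
      (((dA.const_mul 2).fun_mul dB).fun_mul (dC.fun_pow 2))
      (by positivity)
  have d3 : HasDerivAt Y _ t := (d1.fun_mul d2.exp).const_add (-1)
  refine d3.congr_deriv ?_
  generalize Real.exp (h2 t) = E
  unfold h1
  push_cast
  field_simp
  ring

lemma Y_strictMono : StrictMonoOn Y (Set.Ioo (0:ℝ) 1) := by
  apply strictMonoOn_of_deriv_pos (convex_Ioo 0 1)
  · intro t ht
    exact (Y_hasDerivAt t ht.1 ht.2).continuousAt.continuousWithinAt
  · intro t ht
    rw [interior_Ioo] at ht
    obtain ⟨h0, ht1⟩ := ht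
    rw [(Y_hasDerivAt t h0 ht1).deriv]
    have hu : 0 < 1 - t := by linarith
    have hp : 0 < 864+4416*t+7536*t^2+4794*t^3+846*t^4+6*t^5-30*t^6 := by
      have : t^6 ≤ 1 := pow_le_one₀ h0.le ht1.le
      have : 0 < 4416*t+7536*t^2+4794*t^3+846*t^4+6*t^5 := by positivity
      linarith
    have hh : 0 < h1 t := by unfold h1; positivity
    positivity

lemma Y_lo : Y (0.6263716633 - 1e-10) < 1 := by
  have hq : h2 (0.6263716633 - 1e-10) ≤ -0.04601232531479 := by
    unfold h2; norm_num
  have he := Real.exp_le_exp.2 hq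
  have hb := Real.exp_bound (x := -0.04601232531479) (by rw [abs_le]; norm_num) (n := 7) (by norm_num)
  have hb2 := (abs_le.1 hb).2
  simp only [Finset.sum_range_succ, Finset.sum_range_zero, Nat.factorial] at hb2
  have hk : Real.exp (-0.04601232531479) < 2 / 2.09417463253630 := by
    rw [abs_of_neg (by norm_num)] at hb2
    norm_num at hb2 ⊢
    linarith
  have hh : h1 (0.6263716633 - 1e-10) ≤ 2.09417463253630 := by
    unfold h1; norm_num
  have hE := Real.exp_pos (h2 (0.6263716633 - 1e-10))
  unfold Y
  have := mul_le_mul_of_nonneg_right hh hE.le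
  rw [lt_div_iff₀ (by norm_num)] at hk
  linarith

lemma Y_hi : 1 < Y (0.6263716633 + 1e-10) := by
  have hq : -0.04601232529882 ≤ h2 (0.6263716633 + 1e-10) := by
    unfold h2; norm_num
  have he := Real.exp_le_exp.2 hq
  have hb := Real.exp_bound (x := -0.04601232529882) (by rw [abs_le]; norm_num) (n := 7) (by norm_num)
  have hb2 := (abs_le.1 hb).1
  simp only [Finset.sum_range_succ, Finset.sum_range_zero, Nat.factorial] at hb2
  have hk : 2 / 2.09417463359270 < Real.exp (-0.04601232529882) := by
    rw [abs_of_neg (by norm_num)] at hb2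
    norm_num at hb2 ⊢
    linarith
  have hh : 2.09417463359270 ≤ h1 (0.6263716633 + 1e-10) := by
    unfold h1; norm_num
  have hE := Real.exp_pos (h2 (0.6263716633 + 1e-10))
  unfold Y
  have := mul_le_mul_of_nonneg_right hh hE.le
  rw [div_lt_iff₀ (by norm_num)] at hk
  linarith

theorem Y_eq_one_unique :
    (∃! t₀ : ℝ, t₀ ∈ Set.Ioo (0:ℝ) 1 ∧ Y t₀ = 1) ∧
    (∀ t₀ : ℝ, t₀ ∈ Set.Ioo (0:ℝ) 1 → Y t₀ = 1 →
      0.6263716633 - 1e-10 < t₀ ∧ t₀ < 0.6263716633 + 1e-10) := by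
  have ha : (0.6263716633 - 1e-10 : ℝ) ∈ Set.Ioo (0:ℝ) 1 := by constructor <;> norm_num
  have hb : (0.6263716633 + 1e-10 : ℝ) ∈ Set.Ioo (0:ℝ) 1 := by constructor <;> norm_num
  constructor
  · have hc : ContinuousOn Y (Set.Icc (0.6263716633 - 1e-10) (0.6263716633 + 1e-10)) := by
      intro t ht
      exact (Y_hasDerivAt t (ha.1.trans_le ht.1)
        (ht.2.trans_lt hb.2)).continuousAt.continuousWithinAt
    obtain ⟨t, ht, hY⟩ := intermediate_value_Icc (by norm_num) hc ⟨Y_lo.le, Y_hi.le⟩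
    have htm : t ∈ Set.Ioo (0:ℝ) 1 := ⟨ha.1.trans_le ht.1, ht.2.trans_lt hb.2⟩
    refine ⟨t, ⟨htm, hY⟩, ?_⟩
    rintro s ⟨hs, hsY⟩
    exact Y_strictMono.injOn hs htm (hsY.trans hY.symm)
  · intro s hs hY
    constructor
    · rw [← Y_strictMono.lt_iff_lt ha hs, hY]; exact Y_lo
    · rw [← Y_strictMono.lt_iff_lt hs hb, hY]; exact Y_hi
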